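/- arXiv:1206.2962 — 3 statements merged into one kernel-verified Lean document; each statement's English description precedes it below -/
import Mathlib

section
/- Let i, n be natural numbers with 2 ≤ i ≤ n. In the unit group (ℤ/2^(n+1)ℤ)ˣ, the cyclic subgroup generated by the unit 5^(2^(i−2)) equals the cyclic subgroup generated by the unit 1 − 2^i; in particular both subgroups have order 2^(n+1−i). -/
/-- The kernel of reduction `(ℤ/2^N)ˣ → (ℤ/2^m)ˣ` has order `2^(N-m)`. -/
lemma card_ker_unitsMap_two_pow {m N : ℕ} (hm : m ≠ 0) (h : m ≤ N) :
    Nat.card (ZMod.unitsMap (pow_dvd_pow 2 h)).ker = 2 ^ (N - m) := by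
  have hindex := (ZMod.unitsMap (pow_dvd_pow 2 h)).ker.card_mul_index
  have : NeZero N := ⟨by omega⟩
  rw [Subgroup.index_ker, MonoidHom.range_eq_top.2 (ZMod.unitsMap_surjective _),
    Subgroup.card_top, Nat.card_eq_fintype_card (α := (ZMod (2 ^ m))ˣ),
    Nat.card_eq_fintype_card (α := (ZMod (2 ^ N))ˣ), ZMod.card_units_eq_totient,
    ZMod.card_units_eq_totient, Nat.totient_prime_pow Nat.prime_two (by omega),
    Nat.totient_prime_pow Nat.prime_two (by omega)] at hindex
  simp only [Nat.add_one_sub_one, mul_one] at hindex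
  rw [show N - 1 = (N - m) + (m - 1) by omega, pow_add] at hindex
  exact Nat.eq_of_mul_eq_mul_right (by positivity) hindex

/-- A unit modulo `2^N` that is `1` modulo `2^m` and has order `2^(N-m)` generates the kernel
of reduction modulo `2^m`. -/
lemma zpowers_eq_ker_unitsMap_two_pow {m N : ℕ} (hm : m ≠ 0) (h : m ≤ N) (u : (ZMod (2 ^ N))ˣ)
    (hu : ZMod.castHom (pow_dvd_pow 2 h) (ZMod (2 ^ m)) u = 1)
    (hord : orderOf (u : ZMod (2 ^ N)) = 2 ^ (N - m)) :
    Subgroup.zpowers u = (ZMod.unitsMap (pow_dvd_pow 2 h)).ker := by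
  refine Subgroup.eq_of_le_of_card_ge ?_ ?_
  · rw [Subgroup.zpowers_le, MonoidHom.mem_ker]
    ext
    simpa [ZMod.unitsMap_def] using hu
  · rw [card_ker_unitsMap_two_pow hm h, Nat.card_zpowers, ← orderOf_units, hord]

lemma orderOf_five_pow_two_pow {i n : ℕ} (hi : 2 ≤ i) (hn : i ≤ n) :
    orderOf (5 ^ 2 ^ (i - 2) : ZMod (2 ^ (n + 1))) = 2 ^ (n + 1 - i) := by
  obtain ⟨k, rfl⟩ := Nat.exists_eq_add_of_le hi
  obtain ⟨l, rfl⟩ := Nat.exists_eq_add_of_le hn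
  have h5 : orderOf (5 : ZMod (2 ^ (2 + k + l + 1))) = 2 ^ (k + l + 1) := by
    rw [show 2 + k + l + 1 = (k + l + 1) + 2 by ring]
    exact ZMod.orderOf_five _
  rw [orderOf_pow_of_dvd (by positivity) (by rw [h5]; exact pow_dvd_pow 2 (by omega)), h5,
    Nat.pow_div (by omega) two_pos]
  congr 1
  omega

lemma orderOf_one_sub_two_pow {i n : ℕ} (hi : 2 ≤ i) (hn : i ≤ n) :
    orderOf (1 - 2 ^ i : ZMod (2 ^ (n + 1))) = 2 ^ (n + 1 - i) := by
  obtain ⟨l, rfl⟩ := Nat.exists_eq_add_of_le hn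
  have h := ZMod.orderOf_one_add_mul_prime_pow Nat.prime_two i (by omega) (by omega) (-1)
    (by norm_num) (l + 1)
  rw [show l + 1 + i = i + l + 1 by ring] at h
  rw [show i + l + 1 - i = l + 1 by omega, ← h]
  congr 1
  push_cast
  ring

/-- For `2 ≤ i ≤ n`, the subgroups of `(ℤ/2^(n+1)ℤ)ˣ` generated by
`5^(2^(i-2))` and by `1 - 2^i` coincide, and both have order `2^(n+1-i)`. -/
theorem zpowers_five_pow_eq_zpowers_one_sub_two_pow (i n : ℕ) (hi : 2 ≤ i)
    (hn : i ≤ n) (u v : (ZMod (2 ^ (n + 1)))ˣ)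
    (hu : (u : ZMod (2 ^ (n + 1))) = 5 ^ (2 ^ (i - 2)))
    (hv : (v : ZMod (2 ^ (n + 1))) = 1 - 2 ^ i) :
    Subgroup.zpowers u = Subgroup.zpowers v ∧
      Nat.card (Subgroup.zpowers u) = 2 ^ (n + 1 - i) := by
  have hin : i ≤ n + 1 := by omega
  have hu' := zpowers_eq_ker_unitsMap_two_pow (by omega) hin u
    (by
      obtain ⟨k, rfl⟩ := Nat.exists_eq_add_of_le' hi
      rw [hu, map_pow, map_ofNat, Nat.add_sub_cancel, ← ZMod.orderOf_five k]
      exact pow_orderOf_eq_one _)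
    (by rw [hu, orderOf_five_pow_two_pow hi hn])
  have hv' := zpowers_eq_ker_unitsMap_two_pow (by omega) hin v
    (by
      have h2 : (2 : ZMod (2 ^ i)) ^ i = 0 := by exact_mod_cast ZMod.natCast_self (2 ^ i)
      rw [hv, map_sub, map_pow, map_ofNat, map_one, h2, sub_zero])
    (by rw [hv, orderOf_one_sub_two_pow hi hn])
  exact ⟨hu'.trans hv'.symm, by rw [hu', card_ker_unitsMap_two_pow (by omega) hin]⟩
end

section
/- Let n ≥ 2 and let F be a finite field with 5^(2^(n−2)) elements. Then every Sylow 2-subgroup of the special linear group SL(2, F) is isomorphic to the generalized quaternion group of order 2^(n+1). -/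
namespace QuaternionGroup

variable {G : Type*} [Group G] {m : ℕ}

/-- Elements `A`, `X` of a group satisfying the relations `A ^ (2 * m) = 1`, `X ^ 2 = A ^ m` and
`A * X = X * A⁻¹` define a homomorphism from the generalized quaternion group. -/
def lift (A X : G) (hA : A ^ (2 * m) = 1) (hX : X * X = A ^ m) (hAX : A * X = X * A⁻¹) :
    QuaternionGroup m →* G :=
  let f : ZMod (2 * m) →+ Additive G :=
    ZMod.lift (2 * m) ⟨zmultiplesHom (Additive G) (Additive.ofMul A), by
      simpa [← ofMul_zpow] using congrArg Additive.ofMul (show A ^ ((2 * m : ℕ) : ℤ) = 1 by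
        rw [zpow_natCast, hA])⟩
  have hf (k : ℤ) : (f k).toMul = A ^ k := by
    simp [f, ZMod.lift_coe]
  have hX' (k : ℤ) : A ^ k * X = X * A ^ (-k) := by
    have h : SemiconjBy X A⁻¹ A := hAX.symm
    simpa using (h.zpow_right k).eq.symm
  { toFun
      | a i => (f i).toMul
      | xa i => X * (f i).toMul
    map_one' := by
      rw [one_def]
      simp
    map_mul' := by
      rintro (i | i) (j | j) <;>
        obtain ⟨i, rfl⟩ := ZMod.intCast_surjective i <;>
        obtain ⟨j, rfl⟩ := ZMod.intCast_surjective j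
      · simp
      · simp only [a_mul_xa, ← Int.cast_sub, hf]
        rw [← mul_assoc, hX', mul_assoc, ← zpow_add]
        congr 2
        ring
      · simp [mul_assoc]
      · simp only [xa_mul_xa]
        rw [show (m : ZMod (2 * m)) + j - i = ((m + j - i : ℤ) : ZMod (2 * m)) by push_cast; rfl]
        simp only [hf]
        rw [mul_assoc, ← mul_assoc (A ^ i), hX', mul_assoc, ← mul_assoc X X, hX,
          ← zpow_natCast, ← zpow_add, ← zpow_add]
        congr 1
        ring }

variable {A X : G} {hA : A ^ (2 * m) = 1} {hX : X * X = A ^ m} {hAX : A * X = X * A⁻¹}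

@[simp]
theorem lift_a_intCast (k : ℤ) : lift A X hA hX hAX (a k) = A ^ k := by
  simp [lift, ZMod.lift_coe]

@[simp]
theorem lift_xa_intCast (k : ℤ) : lift A X hA hX hAX (xa k) = X * A ^ k := by
  simp [lift, ZMod.lift_coe]

theorem lift_injective (hord : orderOf A = 2 * m) (hmem : X ∉ Subgroup.zpowers A) :
    Function.Injective (lift A X hA hX hAX) := by
  rw [injective_iff_map_eq_one]
  rintro (i | i) h <;> obtain ⟨i, rfl⟩ := ZMod.intCast_surjective i
  · rw [lift_a_intCast, ← orderOf_dvd_iff_zpow_eq_one, hord] at h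
    rw [(ZMod.intCast_zmod_eq_zero_iff_dvd _ _).2 h, a_zero]
  · rw [lift_xa_intCast] at h
    exact absurd ⟨-i, by simp [eq_inv_of_mul_eq_one_left h]⟩ hmem

end QuaternionGroup

namespace Matrix.SpecialLinearGroup

/-- The diagonal torus `u ↦ diag(u, u⁻¹)` of `SL(2, R)`. -/
def diagTorus (R : Type*) [CommRing R] : Rˣ →* SpecialLinearGroup (Fin 2) R where
  toFun u := ⟨!![(u : R), 0; 0, (u⁻¹ : Rˣ)], by simp [det_fin_two]⟩
  map_one' := by ext i j; fin_cases i <;> fin_cases j <;> simp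
  map_mul' u v := by
    apply Subtype.ext
    change !![((u * v : Rˣ) : R), 0; 0, ((u * v)⁻¹ : Rˣ)] =
      !![(u : R), 0; 0, (u⁻¹ : Rˣ)] * !![(v : R), 0; 0, (v⁻¹ : Rˣ)]
    simp [mul_comm]

theorem coe_diagTorus {R : Type*} [CommRing R] (u : Rˣ) :
    (diagTorus R u : Matrix (Fin 2) (Fin 2) R) = !![(u : R), 0; 0, (u⁻¹ : Rˣ)] := rfl

theorem diagTorus_injective (R : Type*) [CommRing R] : Function.Injective (diagTorus R) := by
  intro u v h
  ext
  simpa [coe_diagTorus] using congrArg (fun M : SpecialLinearGroup (Fin 2) R ↦ M.1 0 0) h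

theorem card_mul_card_units {n R : Type*} [Fintype n] [DecidableEq n] [Nonempty n] [CommRing R] :
    Nat.card (SpecialLinearGroup n R) * Nat.card Rˣ = Nat.card (GL n R) := by
  have hker : (GeneralLinearGroup.det (n := n) (R := R)).ker = toGL.range := by
    ext g
    constructor
    · intro hg
      refine ⟨⟨g.1, ?_⟩, ?_⟩
      · simpa using congrArg Units.val (MonoidHom.mem_ker.1 hg)
      · ext i j
        rfl
    · rintro ⟨s, rfl⟩
      rw [MonoidHom.mem_ker]
      ext
      simp
  have hsurj : Function.Surjective (GeneralLinearGroup.det (n := n) (R := R)) := by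
    intro u
    let i₀ : n := Classical.arbitrary n
    refine ⟨GeneralLinearGroup.mk'' (diagonal (Function.update 1 i₀ (u : R))) ?_, ?_⟩
    · simp [det_diagonal, Finset.prod_update_of_mem]
    · ext
      change (diagonal _).det = _
      simp [det_diagonal, Finset.prod_update_of_mem]
  rw [Nat.card_congr (MonoidHom.ofInjective toGL_injective).toEquiv, ← hker,
    ← Nat.card_congr (QuotientGroup.quotientKerEquivOfSurjective _ hsurj).toEquiv, mul_comm,
    ← Subgroup.card_eq_card_quotient_mul_card_subgroup]

theorem card_fin_two (F : Type*) [Field F] [Fintype F] :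
    Nat.card (SpecialLinearGroup (Fin 2) F) =
      Fintype.card F * ((Fintype.card F - 1) * (Fintype.card F + 1)) := by
  have h := card_mul_card_units (n := Fin 2) (R := F)
  have hq : 1 < Fintype.card F := Fintype.one_lt_card
  rw [card_GL_field, Nat.card_units, Nat.card_eq_fintype_card (α := F)] at h
  obtain ⟨r, hr⟩ : ∃ r, Fintype.card F = r + 1 := ⟨_, (Nat.sub_add_cancel hq.le).symm⟩
  simp only [Fin.prod_univ_two, hr, Fin.val_zero, Fin.val_one, pow_zero, pow_one,
    Nat.add_sub_cancel] at h ⊢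
  have h1 : (r + 1) ^ 2 - 1 = r * (r + 2) := Nat.sub_eq_of_eq_add (by ring)
  have h2 : (r + 1) ^ 2 - (r + 1) = r * (r + 1) := Nat.sub_eq_of_eq_add (by ring)
  rw [h1, h2] at h
  apply Nat.eq_of_mul_eq_mul_right (show 0 < r by omega)
  rw [h]
  ring

/-- If `F` contains a unit of order `2 * m` with `m` positive, the generalized
quaternion group of order `4 * m` embeds in `SL(2, F)`. -/
theorem exists_quaternionGroup_injective {F : Type*} [Field F] {m : ℕ} [NeZero m] {ζ : Fˣ}
    (hζ : orderOf ζ = 2 * m) :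
    ∃ f : QuaternionGroup m →* SpecialLinearGroup (Fin 2) F, Function.Injective f := by
  have hζm : ζ ^ m = -1 := by
    have h1 : (ζ ^ m) ^ 2 = 1 := by rw [← pow_mul, mul_comm, ← hζ, pow_orderOf_eq_one]
    refine (Units.eq_or_eq_neg_of_sq_eq_sq _ 1 (by rw [h1, one_pow])).resolve_left fun h ↦ ?_
    have := Nat.le_of_dvd (NeZero.pos m) (orderOf_dvd_of_pow_eq_one h)
    have := NeZero.pos m
    omega
  let X : SpecialLinearGroup (Fin 2) F := ⟨!![0, 1; -1, 0], by simp [det_fin_two]⟩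
  refine ⟨QuaternionGroup.lift (diagTorus F ζ) X ?_ ?_ ?_,
    QuaternionGroup.lift_injective ?_ ?_⟩
  · rw [← map_pow, ← hζ, pow_orderOf_eq_one, map_one]
  · rw [← map_pow, hζm]
    apply Subtype.ext
    rw [coe_mul]
    simp [X, coe_diagTorus]
  · rw [← map_inv]
    apply Subtype.ext
    rw [coe_mul, coe_mul]
    simp [X, coe_diagTorus]
  · rw [orderOf_injective _ (diagTorus_injective F), hζ]
  · rintro ⟨k, hk⟩
    have h : diagTorus F (ζ ^ k) = X := by rw [map_zpow]; exact hk
    exact zero_ne_one (congrArg (fun M : SpecialLinearGroup (Fin 2) F ↦ M.1 0 1) h)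

end Matrix.SpecialLinearGroup

theorem Nat.exists_five_pow_two_pow_eq (k : ℕ) :
    ∃ c, 5 ^ 2 ^ k = 2 ^ (k + 2) * (2 * c + 1) + 1 := by
  induction k with
  | zero => exact ⟨0, by norm_num⟩
  | succ k ih =>
    obtain ⟨c, hc⟩ := ih
    refine ⟨c + 2 ^ k * (2 * c + 1) ^ 2, ?_⟩
    rw [pow_succ, pow_mul, hc]
    ring

/-- For `n ≥ 2` and a finite field `F` with `5^(2^(n-2))` elements, every Sylow
`2`-subgroup of `SL(2, F)` is generalized quaternion of order `2^(n+1)`. -/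
theorem sylow_two_sl2_quaternion (n : ℕ) (hn : 2 ≤ n) (F : Type*) [Field F]
    [Fintype F] (hF : Fintype.card F = 5 ^ (2 ^ (n - 2)))
    (S : Sylow 2 (Matrix.SpecialLinearGroup (Fin 2) F)) :
    Nonempty (S ≃* QuaternionGroup (2 ^ (n - 1))) := by
  obtain ⟨k, rfl⟩ := Nat.exists_eq_add_of_le' hn
  obtain ⟨c, hc⟩ := Nat.exists_five_pow_two_pow_eq k
  rw [Nat.add_sub_cancel, hc] at hF
  rw [show k + 2 - 1 = k + 1 from rfl]
  obtain ⟨ζ, hζ⟩ : ∃ ζ : Fˣ, orderOf ζ = 2 * 2 ^ (k + 1) := by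
    obtain ⟨g, hg⟩ := IsCyclic.exists_ofOrder_eq_natCard (α := Fˣ)
    rw [Nat.card_units, Nat.card_eq_fintype_card, hF, Nat.add_sub_cancel] at hg
    refine ⟨g ^ (2 * c + 1), ?_⟩
    rw [orderOf_pow_of_dvd (by omega) (by simp [hg]), hg, Nat.mul_div_cancel _ (by omega)]
    ring
  obtain ⟨f, hf⟩ := Matrix.SpecialLinearGroup.exists_quaternionGroup_injective hζ
  have hcard : Nat.card f.range =
      2 ^ (Nat.card (Matrix.SpecialLinearGroup (Fin 2) F)).factorization 2 := by
    have hSL : Nat.card (Matrix.SpecialLinearGroup (Fin 2) F) = 2 ^ (k + 3) *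
        ((2 * c + 1) * (2 * (2 ^ (k + 1) * (2 * c + 1)) + 1) *
          (2 * (2 ^ k * (2 * c + 1)) + 1)) := by
      rw [Matrix.SpecialLinearGroup.card_fin_two, hF, Nat.add_sub_cancel]
      ring
    have hfac : (Nat.card (Matrix.SpecialLinearGroup (Fin 2) F)).factorization 2 = k + 3 := by
      rw [hSL, Nat.factorization_mul (by positivity) (by positivity), Finsupp.add_apply,
        Nat.prime_two.factorization_pow, Finsupp.single_eq_same,
        Nat.factorization_eq_zero_of_not_dvd, add_zero]
      simp only [Nat.prime_two.dvd_mul]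
      omega
    rw [hfac, ← Nat.card_congr (MonoidHom.ofInjective hf).toEquiv, Nat.card_eq_fintype_card,
      QuaternionGroup.card]
    ring
  exact ⟨(S.equiv (Sylow.ofCard f.range hcard)).trans (MonoidHom.ofInjective hf).symm⟩
end

section
/- Let G be a finite 2-group containing a subgroup Q of index 2 which is the internal direct product of two cyclic subgroups ⟨x⟩ and ⟨y⟩ with orderOf x = orderOf y = 2^r for some r ≥ 1 (i.e., Q is generated by x and y, x and y commute, and ⟨x⟩ ∩ ⟨y⟩ = 1). Suppose g ∈ G with g ∉ Q, g x g⁻¹ = y and g y g⁻¹ = x. Then there exists an element t ∈ G with t ∉ Q and t² = 1; consequently G is isomorphic to the wreath product C_{2^r} ≀ C₂. -/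
/-- Every element of the subgroup generated by two commuting elements `x`, `y` has the form
`x ^ a * y ^ b`. -/
theorem Commute.exists_zpow_mul_zpow_of_mem_closure_pair {G : Type*} [Group G] {x y z : G}
    (h : Commute x y) (hz : z ∈ Subgroup.closure {x, y}) : ∃ a b : ℤ, z = x ^ a * y ^ b := by
  induction hz using Subgroup.closure_induction with
  | mem z hz =>
    rcases hz with rfl | rfl
    · exact ⟨1, 0, by simp⟩
    · exact ⟨0, 1, by simp⟩
  | one => exact ⟨0, 0, by simp⟩
  | mul u v _ _ hu hv =>
    obtain ⟨a, b, rfl⟩ := hu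
    obtain ⟨c, d, rfl⟩ := hv
    refine ⟨a + c, b + d, ?_⟩
    rw [zpow_add, zpow_add, (h.symm.zpow_zpow b c).mul_mul_mul_comm]
  | inv u _ hu =>
    obtain ⟨a, b, rfl⟩ := hu
    refine ⟨-a, -b, ?_⟩
    rw [mul_inv_rev, ← zpow_neg, ← zpow_neg, (h.zpow_zpow (-a) (-b)).eq]

/-- Let `G` be a finite `2`-group with a subgroup `Q` of index `2` which is the
internal direct product of two cyclic subgroups `⟨x⟩` and `⟨y⟩` of order `2^r`
(`r ≥ 1`). If `g ∈ G \ Q` interchanges `x` and `y` by conjugation, then there is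
an involution outside `Q`; hence `G ≅ C_{2^r} ≀ C₂`. -/
theorem exists_involution_outside (G : Type*) [Group G] [Finite G]
    (hG2 : IsPGroup 2 G) (Q : Subgroup G) (hQ : Q.index = 2)
    (r : ℕ) (hr : 1 ≤ r) (x y : G)
    (hx : orderOf x = 2 ^ r) (hy : orderOf y = 2 ^ r)
    (hgen : Subgroup.closure {x, y} = Q)
    (hcomm : Commute x y)
    (hint : Subgroup.zpowers x ⊓ Subgroup.zpowers y = ⊥)
    (g : G) (hg : g ∉ Q) (hgx : g * x * g⁻¹ = y) (hgy : g * y * g⁻¹ = x) :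
    ∃ t : G, t ∉ Q ∧ t ^ 2 = 1 := by
  have hg2 : g * g ∈ Q := Subgroup.mul_self_mem_of_index_two hQ g
  obtain ⟨a, b, hab⟩ := hcomm.exists_zpow_mul_zpow_of_mem_closure_pair (hgen ▸ hg2)
  have hconj_x (n : ℤ) : g * x ^ n * g⁻¹ = y ^ n := by rw [← conj_zpow, hgx]
  have hconj_y (n : ℤ) : g * y ^ n * g⁻¹ = x ^ n := by rw [← conj_zpow, hgy]
  -- `g` centralizes `g * g`, which forces the two exponents to agree.
  have hswap : x ^ a * y ^ b = x ^ b * y ^ a := calc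
    x ^ a * y ^ b = g * (x ^ a * y ^ b) * g⁻¹ := by rw [← hab]; group
    _ = (g * x ^ a * g⁻¹) * (g * y ^ b * g⁻¹) := by group
    _ = x ^ b * y ^ a := by rw [hconj_x, hconj_y, (hcomm.zpow_zpow b a).eq]
  have hdiff : x ^ (a - b) = y ^ (a - b) := by
    rw [sub_eq_neg_add, zpow_add, zpow_neg, inv_mul_eq_iff_eq_mul, zpow_add, zpow_neg,
      ((Commute.refl y).zpow_zpow b a).inv_left.eq, ← mul_assoc, eq_mul_inv_iff_mul_eq, hswap]
  have hone : x ^ (a - b) = 1 := by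
    rw [← Subgroup.mem_bot, ← hint]
    exact ⟨⟨a - b, rfl⟩, ⟨a - b, hdiff.symm⟩⟩
  have hxab : x ^ a = x ^ b := by rwa [zpow_sub, mul_inv_eq_one] at hone
  have hxQ : x ∈ Q := hgen ▸ Subgroup.subset_closure (by simp)
  refine ⟨x ^ (-b) * g, fun h ↦ hg ((Q.mul_mem_cancel_left (Q.zpow_mem hxQ _)).1 h), ?_⟩
  calc (x ^ (-b) * g) ^ 2 = x ^ (-b) * (g * x ^ (-b) * g⁻¹) * (g * g) := by
        rw [pow_two]; group
    _ = x ^ (-b) * y ^ (-b) * (y ^ b * x ^ b) := by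
        rw [hconj_x, hab, hxab, (hcomm.zpow_zpow b b).eq]
    _ = 1 := by group
end
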